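/- arXiv:1211.3678 — 6 statements merged into one kernel-verified Lean document; each statement's English description precedes it below -/
import Mathlib

section
/- Let A be a finitely cocomplete R-linear category and let Σ be an ind-class in A. Then the class R(Σ) of morphisms is a singleton coverage on A. -/
/-!
STATEMENT 4: Let A be a finitely cocomplete R-linear category and let Σ be an
ind-class in A. Then the class R(Σ) of morphisms is a singleton coverage on A.
-/

open CategoryTheory CategoryTheory.Limits Opposite

universe v u

/-- The sequence `W --p--> V --q--> U → 0` is right exact, i.e. `q` is a cokernel of `p`. -/
def IsRightExactSeq {A : Type u} [Category.{v} A] [Limits.HasZeroMorphisms A]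
    {W V U : A} (p : W ⟶ V) (q : V ⟶ U) : Prop :=
  ∃ w : p ≫ q = 0, Nonempty (IsColimit (CokernelCofork.ofπ q w))

variable {A : Type u} [Category.{v} A]

/-- The class `R(Σ)` of all morphisms `q` appearing as the second morphism of a
sequence in `Σ`. -/
def RClass (S : ∀ ⦃W V U : A⦄, (W ⟶ V) → (V ⟶ U) → Prop) :
    ∀ ⦃V U : A⦄, (V ⟶ U) → Prop :=
  fun V _ q => ∃ (W : A) (p : W ⟶ V), S p q

/-- A class `Σ` of sequences is an ind-class if it consists of right exact sequences and:
(i) for every `q` in `R(Σ)` there is a right exact sequence in `Σ` whose first morphism is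
`q` and whose third object is a zero object; (ii) for every sequence `W --p--> V --q--> U → 0`
in `Σ` and every `f : X ⟶ V` with `f ≫ q = 0` there are `p' : B ⟶ X` in `R(Σ)` and
`f' : B ⟶ W` with `f' ≫ p = p' ≫ f`. -/
def IsIndClass [Limits.HasZeroMorphisms A]
    (S : ∀ ⦃W V U : A⦄, (W ⟶ V) → (V ⟶ U) → Prop) : Prop :=
  (∀ ⦃W V U : A⦄ (p : W ⟶ V) (q : V ⟶ U), S p q → IsRightExactSeq p q) ∧
  (∀ ⦃V U : A⦄ (q : V ⟶ U), RClass S q → ∃ (Z : A) (r : U ⟶ Z), S q r ∧ IsZero Z) ∧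
  (∀ ⦃W V U X : A⦄ (p : W ⟶ V) (q : V ⟶ U), S p q → ∀ f : X ⟶ V, f ≫ q = 0 →
    ∃ (B : A) (p' : B ⟶ X) (f' : B ⟶ W), RClass S p' ∧ f' ≫ p = p' ≫ f)

/-- A class of morphisms `Ξ` is a singleton coverage if every morphism of `Ξ` can be,
up to refinement, pulled back along any morphism: for `q : V ⟶ U` in `Ξ` and
`f : U' ⟶ U` there are `q' : V' ⟶ U'` in `Ξ` and `f' : V' ⟶ V` with `q' ≫ f = f' ≫ q`. -/
def IsSingletonCoverage (Ξ : ∀ ⦃V U : A⦄, (V ⟶ U) → Prop) : Prop :=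
  ∀ ⦃V U : A⦄ (q : V ⟶ U), Ξ q → ∀ ⦃U' : A⦄ (f : U' ⟶ U),
    ∃ (V' : A) (q' : V' ⟶ U') (f' : V' ⟶ V), Ξ q' ∧ q' ≫ f = f' ≫ q

theorem stmt_4 (R : Type v) [CommRing R] {A : Type u} [Category.{v} A]
    [Preadditive A] [CategoryTheory.Linear R A] [HasFiniteColimits A]
    (S : ∀ ⦃W V U : A⦄, (W ⟶ V) → (V ⟶ U) → Prop) (hS : IsIndClass S) :
    IsSingletonCoverage (RClass S) := by
  intro V U q hq U' f
  obtain ⟨Z, r, hr, hZ⟩ := hS.2.1 q hq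
  obtain ⟨B, p', f', hp', h⟩ := hS.2.2 q r hr f (hZ.eq_of_tgt _ _)
  exact ⟨B, p', f', hp', h.symm⟩
end

section
/- Let A be a finitely cocomplete R-linear category and Σ an ind-class in A. If an R-linear functor F : A^op -> Mod_R sends every right exact sequence in Σ to a left exact sequence of R-modules, then F is a sheaf for the singleton coverage R(Σ). In particular, every representable functor A(-,A) is a sheaf for R(Σ). -/
/-!
STATEMENT 5: Let A be a finitely cocomplete R-linear category and Σ an ind-class in A.
If an R-linear functor F : A^op ⥤ Mod_R sends every right exact sequence in Σ to a left
exact sequence of R-modules, then F is a sheaf for the singleton coverage R(Σ).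
In particular, every representable functor A(-,X) is a sheaf for R(Σ).
-/

open CategoryTheory CategoryTheory.Limits Opposite

universe v u

variable {A : Type u} [Category.{v} A]

variable (R : Type v) [CommRing R] [Preadditive A] [CategoryTheory.Linear R A]

/-- A functor `A^op ⥤ Mod_R` is `R`-linear (additive and compatible with the `R`-action). -/
def IsRLinearFunctor (F : Aᵒᵖ ⥤ ModuleCat.{v} R) : Prop :=
  (∀ ⦃X Y : A⦄ (f g : X ⟶ Y), F.map (f + g).op = F.map f.op + F.map g.op) ∧
  (∀ ⦃X Y : A⦄ (r : R) (f : X ⟶ Y), F.map (r • f).op = r • F.map f.op)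

/-- `F` sends each right exact sequence `W --p--> V --q--> U → 0` in `Σ` to a left exact
sequence `0 → F(U) → F(V) → F(W)` of `R`-modules. -/
def SendsToLeftExact (S : ∀ ⦃W V U : A⦄, (W ⟶ V) → (V ⟶ U) → Prop)
    (F : Aᵒᵖ ⥤ ModuleCat.{v} R) : Prop :=
  ∀ ⦃W V U : A⦄ (p : W ⟶ V) (q : V ⟶ U), S p q →
    Function.Injective (F.map q.op) ∧
      ∀ x : F.obj (op V), F.map p.op x = 0 ↔ ∃ y : F.obj (op U), F.map q.op y = x

/-- `F` is a sheaf for the singleton coverage `Ξ`: it sends morphisms of `Ξ` to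
monomorphisms, and for `q : V ⟶ U` in `Ξ` an element `x ∈ F(V)` lies in the image of
`F(q)` iff `F(f)(x) = 0` for every `f : X ⟶ V` with `f ≫ q = 0`. -/
def IsSheafForCoverage (Ξ : ∀ ⦃V U : A⦄, (V ⟶ U) → Prop)
    (F : Aᵒᵖ ⥤ ModuleCat.{v} R) : Prop :=
  (∀ ⦃V U : A⦄ (q : V ⟶ U), Ξ q → Mono (F.map q.op)) ∧
  (∀ ⦃V U : A⦄ (q : V ⟶ U), Ξ q → ∀ x : F.obj (op V),
    (∃ y : F.obj (op U), F.map q.op y = x) ↔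
      (∀ ⦃X : A⦄ (f : X ⟶ V), f ≫ q = 0 → F.map f.op x = 0))

theorem IsRLinearFunctor.map_zero_op {F : Aᵒᵖ ⥤ ModuleCat.{v} R} (hF : IsRLinearFunctor R F)
    (X Y : A) : F.map (0 : X ⟶ Y).op = 0 := by
  simpa using hF.1 (0 : X ⟶ Y) 0

theorem isRLinearFunctor_linearYoneda (X : A) :
    IsRLinearFunctor R ((linearYoneda R A).obj X) := by
  refine ⟨fun Y Z f g => ?_, fun Y Z r f => ?_⟩
  · ext x
    exact Preadditive.add_comp _ _ _ f g x
  · ext x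
    exact Linear.smul_comp _ _ _ r f x

theorem sendsToLeftExact_linearYoneda
    {S : ∀ ⦃W V U : A⦄, (W ⟶ V) → (V ⟶ U) → Prop}
    (hS : ∀ ⦃W V U : A⦄ (p : W ⟶ V) (q : V ⟶ U), S p q → IsRightExactSeq p q) (X : A) :
    SendsToLeftExact R S ((linearYoneda R A).obj X) := by
  intro W V U p q h
  obtain ⟨w, ⟨hc⟩⟩ := hS p q h
  refine ⟨fun a b hab => Cofork.IsColimit.hom_ext hc hab, fun x => ⟨fun hx => ?_, ?_⟩⟩
  · obtain ⟨l, hl⟩ := CokernelCofork.IsColimit.desc' hc x hx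
    exact ⟨l, hl⟩
  · rintro ⟨y, rfl⟩
    have h_comp (y : U ⟶ X) : p ≫ q ≫ y = 0 := by rw [reassoc_of% w, zero_comp]
    exact h_comp y

theorem SendsToLeftExact.isSheafForCoverage
    {S : ∀ ⦃W V U : A⦄, (W ⟶ V) → (V ⟶ U) → Prop}
    (hS : ∀ ⦃W V U : A⦄ (p : W ⟶ V) (q : V ⟶ U), S p q → IsRightExactSeq p q)
    {F : Aᵒᵖ ⥤ ModuleCat.{v} R} (hF : IsRLinearFunctor R F) (hE : SendsToLeftExact R S F) :
    IsSheafForCoverage R (RClass S) F := by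
  refine ⟨fun V U q ⟨W, p, h⟩ => (ModuleCat.mono_iff_injective _).2 (hE p q h).1,
    fun V U q ⟨W, p, h⟩ x => ⟨?_, fun hx => ((hE p q h).2 x).1 (hx p (hS p q h).choose)⟩⟩
  rintro ⟨y, rfl⟩ X f hf
  rw [← ConcreteCategory.comp_apply, ← F.map_comp, ← op_comp, hf, hF.map_zero_op]
  rfl

theorem stmt_5 {A : Type u} [Category.{v} A] (R : Type v) [CommRing R]
    [Preadditive A] [CategoryTheory.Linear R A] [HasFiniteColimits A]
    (S : ∀ ⦃W V U : A⦄, (W ⟶ V) → (V ⟶ U) → Prop) (hS : IsIndClass S) :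
    (∀ F : Aᵒᵖ ⥤ ModuleCat.{v} R, IsRLinearFunctor R F → SendsToLeftExact R S F →
      IsSheafForCoverage R (RClass S) F) ∧
    (∀ X : A, IsSheafForCoverage R (RClass S) ((linearYoneda R A).obj X)) := by
  exact ⟨fun _ hF hE => hE.isSheafForCoverage R hS.1 hF, fun X =>
    (sendsToLeftExact_linearYoneda R hS.1 X).isSheafForCoverage R hS.1
      (isRLinearFunctor_linearYoneda R X)⟩
end

section
/- Let A be a finitely cocomplete R-linear category, Σ an ind-class in A, and Sh(A) the category of sheaves for the singleton coverage R(Σ). For every right exact sequence W --p--> V --q--> U -> 0 in Σ, the sequence A(-,W) -> A(-,V) -> A(-,U) -> 0 obtained by applying the Yoneda embedding is right exact in Sh(A). -/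
/-!
STATEMENT 6: Let A be a finitely cocomplete R-linear category, Σ an ind-class in A, and
Sh(A) the category of sheaves for the singleton coverage R(Σ) (a full subcategory of the
category of R-linear presheaves). For every right exact sequence W --p--> V --q--> U → 0
in Σ, the sequence A(-,W) → A(-,V) → A(-,U) → 0 obtained by applying the Yoneda embedding
is right exact in Sh(A); i.e. the composite is zero and A(-,q) satisfies the universal
property of the cokernel of A(-,p) among sheaves.
-/

open CategoryTheory CategoryTheory.Limits Opposite

universe v u

variable {A : Type u} [Category.{v} A]

variable (R : Type v) [CommRing R] [Preadditive A] [CategoryTheory.Linear R A]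

/-- The morphism of presheaves `A(-, U) ⟶ F` attached to an element `y ∈ F(U)` by the linear
Yoneda lemma. -/
def linearYonedaOfElement {A : Type u} [Category.{v} A] (R : Type v) [CommRing R]
    [Preadditive A] [CategoryTheory.Linear R A] {F : Aᵒᵖ ⥤ ModuleCat.{v} R}
    (hF : IsRLinearFunctor R F) {U : A} (y : F.obj (op U)) : (linearYoneda R A).obj U ⟶ F where
  app X := ModuleCat.ofHom
    { toFun := fun g : X.unop ⟶ U => F.map g.op y
      map_add' := fun f g => by rw [hF.1]; rfl
      map_smul' := fun r f => by rw [hF.2]; rfl }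
  naturality X Y f := by
    ext (g : X.unop ⟶ U)
    change F.map (f.unop ≫ g).op y = F.map f (F.map g.op y)
    simp

theorem linearYoneda_hom_apply {A : Type u} [Category.{v} A] (R : Type v) [CommRing R]
    [Preadditive A] [CategoryTheory.Linear R A] {F : Aᵒᵖ ⥤ ModuleCat.{v} R} {U X : A}
    (β : (linearYoneda R A).obj U ⟶ F) (g : X ⟶ U) :
    β.app (op X) g = F.map g.op (β.app (op U) (𝟙 U)) := by
  have h := ConcreteCategory.congr_hom (β.naturality g.op) (𝟙 U)
  change β.app (op X) (g ≫ 𝟙 U) = F.map g.op (β.app (op U) (𝟙 U)) at h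
  rwa [Category.comp_id] at h

theorem linearYoneda_hom_ext {A : Type u} [Category.{v} A] (R : Type v) [CommRing R]
    [Preadditive A] [CategoryTheory.Linear R A] {F : Aᵒᵖ ⥤ ModuleCat.{v} R} {U : A}
    {β γ : (linearYoneda R A).obj U ⟶ F}
    (h : β.app (op U) (𝟙 U) = γ.app (op U) (𝟙 U)) : β = γ := by
  ext X (g : X.unop ⟶ U)
  exact (linearYoneda_hom_apply R β g).trans
    ((congrArg (F.map g.op) h).trans (linearYoneda_hom_apply R γ g).symm)

theorem linearYoneda_map_comp_app_id {A : Type u} [Category.{v} A] (R : Type v) [CommRing R]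
    [Preadditive A] [CategoryTheory.Linear R A] {F : Aᵒᵖ ⥤ ModuleCat.{v} R} {V U : A}
    (q : V ⟶ U) (β : (linearYoneda R A).obj U ⟶ F) :
    ((linearYoneda R A).map q ≫ β).app (op V) (𝟙 V) =
      F.map q.op (β.app (op U) (𝟙 U)) := by
  rw [← linearYoneda_hom_apply]
  change β.app (op V) (𝟙 V ≫ q) = β.app (op V) q
  rw [Category.id_comp]

/-- For an ind-class, an element of a separated presheaf killed by the first morphism of a
sequence in the class is killed by every morphism whose composite with the second one is zero. -/
theorem IsIndClass.map_apply_eq_zero {A : Type u} [Category.{v} A] (R : Type v) [CommRing R]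
    [Preadditive A] {S : ∀ ⦃W V U : A⦄, (W ⟶ V) → (V ⟶ U) → Prop} (hS : IsIndClass S)
    {F : Aᵒᵖ ⥤ ModuleCat.{v} R}
    (hF : ∀ ⦃V U : A⦄ (q : V ⟶ U), RClass S q → Mono (F.map q.op))
    {W V U X : A} {p : W ⟶ V} {q : V ⟶ U} (hpq : S p q) {a : F.obj (op V)}
    (ha : F.map p.op a = 0) {f : X ⟶ V} (hf : f ≫ q = 0) : F.map f.op a = 0 := by
  obtain ⟨B, p', f', hp', e⟩ := hS.2.2 p q hpq f hf
  apply (ModuleCat.mono_iff_injective _).1 (hF p' hp')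
  have h : F.map (p' ≫ f).op a = F.map (f' ≫ p).op a := by rw [e]
  simpa [ha] using h

theorem stmt_6 {A : Type u} [Category.{v} A] (R : Type v) [CommRing R]
    [Preadditive A] [CategoryTheory.Linear R A] [HasFiniteColimits A]
    (S : ∀ ⦃W V U : A⦄, (W ⟶ V) → (V ⟶ U) → Prop) (hS : IsIndClass S)
    ⦃W V U : A⦄ (p : W ⟶ V) (q : V ⟶ U) (hpq : S p q) :
    (linearYoneda R A).map p ≫ (linearYoneda R A).map q = 0 ∧
    (∀ (F : Aᵒᵖ ⥤ ModuleCat.{v} R), IsRLinearFunctor R F →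
      IsSheafForCoverage R (RClass S) F →
      ∀ (α : (linearYoneda R A).obj V ⟶ F), (linearYoneda R A).map p ≫ α = 0 →
        ∃! β : (linearYoneda R A).obj U ⟶ F, (linearYoneda R A).map q ≫ β = α) := by
  obtain ⟨w, -⟩ := hS.1 p q hpq
  refine ⟨?_, fun F hF hsh α hα => ?_⟩
  · rw [← Functor.map_comp, w]
    ext X (g : X.unop ⟶ W)
    exact comp_zero
  have ha : F.map p.op (α.app (op V) (𝟙 V)) = 0 := by
    rw [← linearYoneda_map_comp_app_id, hα]
    rfl
  obtain ⟨y, hy⟩ := (hsh.2 q ⟨W, p, hpq⟩ (α.app (op V) (𝟙 V))).2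
    fun X f hf => hS.map_apply_eq_zero R hsh.1 hpq ha hf
  have hy_id : (linearYonedaOfElement R hF y).app (op U) (𝟙 U) = y := by
    change F.map (𝟙 U).op y = y
    simp
  refine ⟨linearYonedaOfElement R hF y, ?_, fun β hβ => ?_⟩
  · apply linearYoneda_hom_ext
    rw [linearYoneda_map_comp_app_id, hy_id, hy]
  · apply linearYoneda_hom_ext
    apply (ModuleCat.mono_iff_injective _).1 (hsh.1 q ⟨W, p, hpq⟩)
    rw [hy_id, hy, ← linearYoneda_map_comp_app_id, hβ]
end

section
/- Let A be a finitely cocomplete R-linear category and Σ an ind-class in A. An R-linear functor F : A^op -> Mod_R is a sheaf for the singleton coverage R(Σ) if and only if F sends every right exact sequence in Σ to a left exact sequence of R-modules. -/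
/-!
STATEMENT 7: Let A be a finitely cocomplete R-linear category and Σ an ind-class in A.
An R-linear functor F : A^op ⥤ Mod_R is a sheaf for the singleton coverage R(Σ) if and
only if F sends every right exact sequence in Σ to a left exact sequence of R-modules.
-/

open CategoryTheory CategoryTheory.Limits Opposite

universe v u

variable {A : Type u} [Category.{v} A]

variable (R : Type v) [CommRing R] [Preadditive A] [CategoryTheory.Linear R A]

theorem map_map_eq_zero_of_comp_eq_zero {A : Type u} [Category.{v} A] (R : Type v) [CommRing R]
    [Preadditive A] [CategoryTheory.Linear R A]
    {F : Aᵒᵖ ⥤ ModuleCat.{v} R} (hF : IsRLinearFunctor R F) {X V U : A} {f : X ⟶ V} {q : V ⟶ U}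
    (h : f ≫ q = 0) (y : F.obj (op U)) : F.map f.op (F.map q.op y) = 0 := by
  have hzero : F.map (0 : X ⟶ U).op = 0 := by
    simpa using hF.1 (0 : X ⟶ U) 0
  rw [← ConcreteCategory.comp_apply, ← F.map_comp, ← op_comp, h, hzero]
  rfl

theorem stmt_7 {A : Type u} [Category.{v} A] (R : Type v) [CommRing R]
    [Preadditive A] [CategoryTheory.Linear R A] [HasFiniteColimits A]
    (S : ∀ ⦃W V U : A⦄, (W ⟶ V) → (V ⟶ U) → Prop) (hS : IsIndClass S)
    (F : Aᵒᵖ ⥤ ModuleCat.{v} R) (hF : IsRLinearFunctor R F) :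
    IsSheafForCoverage R (RClass S) F ↔ SendsToLeftExact R S F := by
  obtain ⟨rightExact, -, hlift⟩ := hS
  constructor
  · rintro ⟨mono, glue⟩ W V U p q hpq
    refine ⟨(ModuleCat.mono_iff_injective _).1 (mono q ⟨W, p, hpq⟩), fun x => ⟨fun hx => ?_, ?_⟩⟩
    · refine (glue q ⟨W, p, hpq⟩ x).2 fun X f hf => ?_
      obtain ⟨B, p', f', hp', comm⟩ := hlift p q hpq f hf
      apply (ModuleCat.mono_iff_injective _).1 (mono p' hp')
      rw [map_zero, ← ConcreteCategory.comp_apply, ← F.map_comp, ← op_comp, ← comm, op_comp,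
        F.map_comp, ConcreteCategory.comp_apply, hx, map_zero]
    · rintro ⟨y, rfl⟩
      exact map_map_eq_zero_of_comp_eq_zero R hF (rightExact p q hpq).1 y
  · intro h
    refine ⟨?_, ?_⟩
    · rintro V U q ⟨W, p, hpq⟩
      exact (ModuleCat.mono_iff_injective _).2 (h p q hpq).1
    · rintro V U q ⟨W, p, hpq⟩ x
      refine ⟨?_, fun hx => ((h p q hpq).2 x).1 (hx p (rightExact p q hpq).1)⟩
      rintro ⟨y, rfl⟩ X f hf
      exact map_map_eq_zero_of_comp_eq_zero R hF hf y
end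

section
/- Let A be an ind-abelian symmetric monoidal R-linear category in which every object admits an epimorphism from an object possessing a dual. Then for every object A of A there exists a right exact sequence D' -> D -> A -> 0 in A in which both D and D' possess duals. -/
/-!
STATEMENT 18: Let A be an ind-abelian symmetric monoidal R-linear category in which
every object admits an epimorphism from an object possessing a dual. Then for every
object X of A there exists a right exact sequence D' → D → X → 0 in A in which both
D and D' possess duals.
-/

open CategoryTheory CategoryTheory.Limits Opposite

universe v u

/-- A finitely cocomplete `R`-linear category `A` is ind-abelian. -/
def IsIndAbelian (R : Type v) [CommRing R] (A : Type u) [Category.{v} A]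
    [Preadditive A] [CategoryTheory.Linear R A] : Prop :=
  (∀ ⦃X Y : A⦄ (f : X ⟶ Y), Epi f → ∃ (Z : A) (g : Z ⟶ X), IsRightExactSeq g f) ∧
  (∀ ⦃W V U X : A⦄ (p : W ⟶ V) (q : V ⟶ U), IsRightExactSeq p q →
    ∀ f : X ⟶ V, f ≫ q = 0 →
      ∃ (B : A) (p' : B ⟶ X) (f' : B ⟶ W), Epi p' ∧ f' ≫ p = p' ≫ f)

/-- Right exactness is preserved by precomposing the first map with an epimorphism. -/
theorem IsRightExactSeq.epi_comp {A : Type u} [Category.{v} A] [HasZeroMorphisms A]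
    {W V U Z : A} {p : W ⟶ V} {q : V ⟶ U} (h : IsRightExactSeq p q) (e : Z ⟶ W) [Epi e] :
    IsRightExactSeq (e ≫ p) q := by
  obtain ⟨w, ⟨hc⟩⟩ := h
  exact ⟨by rw [Category.assoc, w, comp_zero], ⟨isCokernelEpiComp hc e rfl⟩⟩

theorem stmt_18 (R : Type v) [CommRing R] (A : Type u) [Category.{v} A]
    [Preadditive A] [CategoryTheory.Linear R A] [HasFiniteColimits A]
    [MonoidalCategory A] [SymmetricCategory A]
    (hind : IsIndAbelian R A)
    (hdual : ∀ X : A, ∃ (X' : A) (p : X' ⟶ X), Epi p ∧ Nonempty (HasRightDual X')) :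
    ∀ X : A, ∃ (D' D : A) (f : D' ⟶ D) (g : D ⟶ X),
      Nonempty (HasRightDual D') ∧ Nonempty (HasRightDual D) ∧ IsRightExactSeq f g := by
  intro X
  obtain ⟨D, g, hg, hD⟩ := hdual X
  obtain ⟨Z, k, hk⟩ := hind.1 g hg
  obtain ⟨D', e, _, hD'⟩ := hdual Z
  exact ⟨D', D, e ≫ k, g, hD', hD, hk.epi_comp e⟩
end

section
/- Let C and D be symmetric monoidal categories with arbitrary coproducts, and let F : C -> D be a strong symmetric monoidal functor admitting a right adjoint G such that the counit ε : F∘G ⇒ id is an epimorphism at every object. If every object of C admits an epimorphism from a coproduct of dualizable objects, then every object of D admits an epimorphism from a coproduct of dualizable objects. -/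
/-!
STATEMENT 19: Let C and D be symmetric monoidal categories with arbitrary coproducts and
F : C ⥤ D a strong symmetric monoidal functor admitting a right adjoint G such that the
counit ε : F∘G ⇒ id is an epimorphism at every object. If every object of C admits an
epimorphism from a coproduct of dualizable objects, then every object of D admits an
epimorphism from a coproduct of dualizable objects.
-/

open CategoryTheory CategoryTheory.Limits

universe w v₁ v₂ u₁ u₂

/-- Every object of `C` admits an epimorphism from a coproduct of dualizable objects. -/
def HasEnoughDualizables (C : Type u₁) [Category.{v₁} C] [MonoidalCategory C]
    [HasCoproducts.{w} C] : Prop :=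
  ∀ M : C, ∃ (ι : Type w) (N : ι → C),
    (∀ i, Nonempty (HasRightDual (N i))) ∧ ∃ e : (∐ N) ⟶ M, Epi e

open MonoidalCategory Functor.LaxMonoidal Functor.OplaxMonoidal in
/-- A strong monoidal functor sends exact pairings to exact pairings. -/
@[reducible]
def exactPairingMap {C : Type u₁} {D : Type u₂} [Category.{v₁} C] [Category.{v₂} D]
    [MonoidalCategory C] [MonoidalCategory D] (F : C ⥤ D) [F.Monoidal]
    (X Y : C) [ExactPairing X Y] : ExactPairing (F.obj X) (F.obj Y) where
  coevaluation' := ε F ≫ F.map (η_ X Y) ≫ δ F X Y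
  evaluation' := μ F Y X ≫ F.map (ε_ X Y) ≫ η F
  coevaluation_evaluation' := by
    simp only [Functor.LaxMonoidal.right_unitality, Functor.OplaxMonoidal.left_unitality,
      Category.assoc]
    rw [← F.map_comp_assoc, ← ExactPairing.coevaluation_evaluation X Y]
    simp only [Functor.map_comp, Functor.Monoidal.map_whiskerLeft,
      Functor.Monoidal.map_whiskerRight, Functor.Monoidal.map_associator_inv, Category.assoc,
      Functor.Monoidal.μ_δ_assoc, whiskerLeft_comp, comp_whiskerRight]
  evaluation_coevaluation' := by
    simp only [Functor.LaxMonoidal.left_unitality, Functor.OplaxMonoidal.right_unitality,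
      Category.assoc]
    rw [← F.map_comp_assoc, ← ExactPairing.evaluation_coevaluation X Y]
    simp only [Functor.map_comp, Functor.Monoidal.map_whiskerLeft,
      Functor.Monoidal.map_whiskerRight, Functor.Monoidal.map_associator, Category.assoc,
      Functor.Monoidal.μ_δ_assoc, whiskerLeft_comp, comp_whiskerRight]

theorem stmt_19 {C : Type u₁} {D : Type u₂} [Category.{v₁} C] [Category.{v₂} D]
    [MonoidalCategory C] [SymmetricCategory C] [MonoidalCategory D] [SymmetricCategory D]
    [HasCoproducts.{w} C] [HasCoproducts.{w} D]
    (F : C ⥤ D) [F.Braided] (G : D ⥤ C) (adj : F ⊣ G)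
    (hcounit : ∀ X : D, Epi (adj.counit.app X))
    (hC : HasEnoughDualizables.{w} C) :
    HasEnoughDualizables.{w} D := by
  intro M
  obtain ⟨ι, N, hN, e, he⟩ := hC (G.obj M)
  have : PreservesColimitsOfSize.{w, w} F := adj.leftAdjoint_preservesColimits
  have := hcounit M
  have := Functor.preservesEpimorphisms_of_adjunction adj
  have : Epi (F.map e) := F.map_epi e
  refine ⟨ι, fun i => F.obj (N i), fun i => ?_,
    (PreservesCoproduct.iso F N).inv ≫ F.map e ≫ adj.counit.app M, inferInstance⟩
  obtain ⟨_⟩ := hN i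
  exact ⟨@HasRightDual.mk _ _ _ _ (F.obj (HasRightDual.rightDual (N i))) (exactPairingMap F _ _)⟩
end
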